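/- Let n be a positive integer. There exists a positive integer N = N(n) such that if X is a linked set in a finite digraph D and A, B ⊆ X are disjoint with |A| = |B| = N, then one of the following holds: (1) there are A* ⊆ A and B* ⊆ B with |A*| = |B*| = n, a linkage of n pairwise vertex-disjoint directed paths from A* to B*, and a linkage of n pairwise vertex-disjoint directed paths from B* to A*, such that the two linkages agree and the paths of the two linkages are pairwise vertex-disjoint except that the two directed paths joining the same pair of vertices may share vertices; or (2) D has a 4-eulerianizable subdigraph D′ with a haven of order n + 1. -/

import Mathlib

/-- A directed path in the digraph with adjacency relation `A`: a nonempty list of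
distinct vertices in which each consecutive pair is joined by an edge directed forwards. -/
def IsDipath {V : Type*} (A : V → V → Prop) (l : List V) : Prop :=
  l ≠ [] ∧ l.Nodup ∧ l.Chain' A

/-- A directed path all of whose vertices lie in the set `S`. -/
def DipathIn {V : Type*} (A : V → V → Prop) (S : Set V) (l : List V) : Prop :=
  IsDipath A l ∧ ∀ v ∈ l, v ∈ S

/-- A directed path from `u` to `v`. -/
def DipathFromTo {V : Type*} (A : V → V → Prop) (l : List V) (u v : V) : Prop :=
  IsDipath A l ∧ l.head? = some u ∧ l.getLast? = some v

/-- The digraph with adjacency `A` is strongly connected on the vertex set `S`: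
any vertex of `S` can reach any other by a directed path staying inside `S`. -/
def StrongOn {V : Type*} (A : V → V → Prop) (S : Set V) : Prop :=
  ∀ u ∈ S, ∀ v ∈ S, ∃ l : List V, DipathIn A S l ∧ l.head? = some u ∧ l.getLast? = some v

/-- `C` is (the vertex set of) a strong component of the subdigraph induced on `W`:
a maximal nonempty strongly connected subset of `W`. -/
def IsStrongComponent {V : Type*} (A : V → V → Prop) (W C : Set V) : Prop :=
  C ⊆ W ∧ C.Nonempty ∧ StrongOn A C ∧
    ∀ C' : Set V, C ⊆ C' → C' ⊆ W → StrongOn A C' → C' = C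

/-- `B` is a haven of order `w` in the digraph with adjacency `A` and vertex set `S`:
for every `Z ⊆ S` with `|Z| < w`, `B Z` is a strong component of the digraph minus `Z`,
and `B Z ⊆ B Z'` whenever `Z' ⊆ Z` (the haven axiom). -/
def IsHavenOn {V : Type*} (A : V → V → Prop) (S : Set V) (w : ℕ) (B : Finset V → Set V) : Prop :=
  ∀ Z : Finset V, ↑Z ⊆ S → Z.card < w →
    IsStrongComponent A (S \ ↑Z) (B Z) ∧ ∀ Z' : Finset V, Z' ⊆ Z → B Z ⊆ B Z'

/-- The digraph with adjacency `A` and vertex set `S` has a haven of order `w`. -/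
def HasHavenOn {V : Type*} (A : V → V → Prop) (S : Set V) (w : ℕ) : Prop :=
  ∃ B : Finset V → Set V, IsHavenOn A S w B

/-- The digraph with adjacency `A` (on its whole vertex type) has a haven of order `w`. -/
def HasHaven {V : Type*} (A : V → V → Prop) (w : ℕ) : Prop :=
  HasHavenOn A Set.univ w

/-- A linkage from the finite set `S` to the finite set `T`: for each `a ∈ S`,
`P a` is a directed path from `a` to `τ a ∈ T`, and the paths are pairwise vertex-disjoint
(so the ends `τ a` are distinct vertices of `T`). -/
def IsLinkage {V : Type*} (A : V → V → Prop) (S T : Finset V)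
    (P : V → List V) (τ : V → V) : Prop :=
  (∀ a ∈ S, τ a ∈ T ∧ DipathFromTo A (P a) a (τ a)) ∧
  ∀ a₁ ∈ S, ∀ a₂ ∈ S, a₁ ≠ a₂ → ∀ v ∈ P a₁, v ∉ P a₂

/-- `X` is linked: for every `S, T ⊆ X` with `|S| = |T|` there is a linkage of `|S|`
pairwise vertex-disjoint directed paths from `S` to `T`. -/
def Linked {V : Type*} (A : V → V → Prop) (X : Finset V) : Prop :=
  ∀ S T : Finset V, S ⊆ X → T ⊆ X → S.card = T.card →
    ∃ (P : V → List V) (τ : V → V), IsLinkage A S T P τ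

/-- `(S, A')` is a subdigraph of the digraph with adjacency `A`: every edge of `A'`
is an edge of `A` with both ends in `S`. -/
def IsSubdigraph {V : Type*} (A : V → V → Prop) (S : Set V) (A' : V → V → Prop) : Prop :=
  ∀ u v, A' u v → A u v ∧ u ∈ S ∧ v ∈ S

/-- The digraph with adjacency `A` and vertex set `S` is `k`-eulerianizable: it is strongly
connected and one can assign a positive multiplicity to each edge so that at every vertex the
total multiplicity of in-edges equals that of the out-edges and both are at most `k`. -/
def Eulerianizable {V : Type*} [Fintype V] (A : V → V → Prop) (S : Set V) (k : ℕ) : Prop :=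
  StrongOn A S ∧ ∃ m : V → V → ℕ,
    (∀ u v, A u v → 1 ≤ m u v) ∧ (∀ u v, ¬ A u v → m u v = 0) ∧
    ∀ v ∈ S, (∑ u, m u v) = (∑ u, m v u) ∧ (∑ u, m v u) ≤ k

/-- With respect to the orders given by `f` on `S` and `g` on the target set, the end map `τ`
of a linkage starting in `S` is monotone increasing. -/
def MonoIncrOn {V : Type*} (S : Finset V) (τ : V → V) (f g : V → ℕ) : Prop :=
  ∀ a₁ ∈ S, ∀ a₂ ∈ S, f a₁ < f a₂ → g (τ a₁) < g (τ a₂)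

/-- With respect to the orders given by `f` on `S` and `g` on the target set, the end map `τ`
of a linkage starting in `S` is monotone decreasing. -/
def MonoDecrOn {V : Type*} (S : Finset V) (τ : V → V) (f g : V → ℕ) : Prop :=
  ∀ a₁ ∈ S, ∀ a₂ ∈ S, f a₁ < f a₂ → g (τ a₂) < g (τ a₁)

/-- A linkage from `S` to `T` (with end map `τ`) and one from `T` to `S` (with end map `σ`)
agree: there are linear orders on `S` and on `T` making both monotone increasing. -/
def LinkagesAgree {V : Type*} (S T : Finset V) (τ σ : V → V) : Prop :=
  ∃ f g : V → ℕ, Set.InjOn f ↑S ∧ Set.InjOn g ↑T ∧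
    MonoIncrOn S τ f g ∧ MonoIncrOn T σ g f

/-- The two linkages cross: there are linear orders on `S` and on `T` making one of them
monotone increasing and the other monotone decreasing. -/
def LinkagesCross {V : Type*} (S T : Finset V) (τ σ : V → V) : Prop :=
  ∃ f g : V → ℕ, Set.InjOn f ↑S ∧ Set.InjOn g ↑T ∧
    ((MonoIncrOn S τ f g ∧ MonoDecrOn T σ g f) ∨
     (MonoDecrOn S τ f g ∧ MonoIncrOn T σ g f))

open Relation

/-- `v` is reachable from `u` by steps of `r` all of whose vertices lie in `W`. -/
def ReachIn {V : Type*} (r : V → V → Prop) (W : Set V) (u v : V) : Prop :=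
  u ∈ W ∧ ReflTransGen (fun x y => r x y ∧ y ∈ W) u v

section Reachability

variable {V : Type*} {r : V → V → Prop} {W : Set V} {u v w : V}

lemma ReachIn.refl (hu : u ∈ W) : ReachIn r W u u := ⟨hu, .refl⟩

lemma ReachIn.mem_right (h : ReachIn r W u v) : v ∈ W := by
  obtain ⟨hu, h⟩ := h
  induction h with
  | refl => exact hu
  | tail _ h _ => exact h.2

lemma ReachIn.trans (h : ReachIn r W u v) (h' : ReachIn r W v w) : ReachIn r W u w :=
  ⟨h.1, h.2.trans h'.2⟩

lemma ReachIn.mono {r' : V → V → Prop} {W' : Set V} (h : ReachIn r W u v)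
    (hr : ∀ x y, r x y → r' x y) (hW : W ⊆ W') : ReachIn r' W' u v :=
  ⟨hW h.1, ReflTransGen.mono (fun x y hxy => ⟨hr x y hxy.1, hW hxy.2⟩) _ _ h.2⟩

lemma ReachIn.single (hu : u ∈ W) (hv : v ∈ W) (h : r u v) : ReachIn r W u v :=
  ⟨hu, .single ⟨h, hv⟩⟩

/-- All vertices of a walk can be taken to satisfy any property that propagates along it. -/
lemma ReachIn.restrict {C : Set V} (h : ReachIn r W u v) (hu : u ∈ C)
    (hC : ∀ x, ReachIn r W u x → ReachIn r W x v → x ∈ C) : ReachIn r C u v := by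
  obtain ⟨huW, h⟩ := h
  refine ⟨hu, ?_⟩
  induction h using ReflTransGen.head_induction_on with
  | refl => exact .refl
  | @head x y hxy hyv ih =>
    have hy : y ∈ C := hC y ⟨huW, .single hxy⟩ ⟨hxy.2, hyv⟩
    exact .head ⟨hxy.1, hy⟩ (ih hy
      (fun z hyz hzv => hC z ⟨huW, .head hxy hyz.2⟩ hzv) hxy.2)

lemma ReachIn.exists_dipathIn (h : ReachIn r W u v) :
    ∃ l : List V, DipathIn r W l ∧ l.head? = some u ∧ l.getLast? = some v := by
  obtain ⟨huW, h⟩ := h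
  induction h using ReflTransGen.head_induction_on with
  | refl => exact ⟨[v], ⟨⟨by simp, by simp, List.isChain_singleton _⟩, by simpa using huW⟩,
      by simp, by simp⟩
  | @head x y hxy _ ih =>
    obtain ⟨l, ⟨⟨hne, hnd, hch⟩, hW⟩, hhd, hlast⟩ := ih hxy.2
    by_cases hx : x ∈ l
    · obtain ⟨s, t, rfl⟩ := List.append_of_mem hx
      refine ⟨x :: t, ⟨⟨by simp, (List.nodup_append.1 hnd).2.1, ?_⟩, fun z hz => hW z ?_⟩,
        by simp, ?_⟩
      · exact (List.isChain_append.1 hch).2.1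
      · exact List.mem_append_right _ hz
      · simpa [List.getLast?_append] using hlast
    · refine ⟨x :: l, ⟨⟨by simp, List.nodup_cons.2 ⟨hx, hnd⟩, ?_⟩, ?_⟩, by simp, ?_⟩
      · refine List.isChain_cons.2 ⟨fun z hz => ?_, hch⟩
        rw [hhd] at hz
        simp only [Option.mem_def, Option.some.injEq] at hz
        exact hz ▸ hxy.1
      · intro z hz
        rcases List.mem_cons.1 hz with rfl | hz
        · exact huW
        · exact hW z hz
      · cases l with
        | nil => simp at hne
        | cons a l => simpa [List.getLast?_cons_cons] using hlast

lemma reachIn_of_isChain_append {s : List V} {t : List V} (hch : (s ++ v :: t).IsChain r)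
    (hW : ∀ x ∈ s ++ v :: t, x ∈ W) (hu : (s ++ [v]).head? = some u) : ReachIn r W u v := by
  induction s generalizing u with
  | nil =>
    simp only [List.nil_append, List.head?_cons, Option.some.injEq] at hu
    subst hu
    exact .refl (hW _ (by simp))
  | cons a s ih =>
    simp only [List.cons_append, List.head?_cons, Option.some.injEq] at hu
    subst hu
    obtain ⟨b, hb⟩ : ∃ b, (s ++ [v]).head? = some b := by cases s <;> simp
    have hb' : (s ++ v :: t).head? = some b := by cases s <;> simpa using hb
    have hch' := List.isChain_cons.1 (by simpa using hch : (a :: (s ++ v :: t)).IsChain r)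
    have h := ih hch'.2 (fun x hx => hW x (by simp at hx ⊢; tauto)) hb
    exact (ReachIn.single (hW a (by simp)) h.1 (hch'.1 b hb')).trans h

lemma reachIn_of_head {l : List V} (hch : l.IsChain r) (hW : ∀ x ∈ l, x ∈ W)
    (hu : l.head? = some u) (hv : v ∈ l) : ReachIn r W u v := by
  obtain ⟨s, t, rfl⟩ := List.append_of_mem hv
  refine reachIn_of_isChain_append hch hW ?_
  cases s <;> simpa using hu

lemma reachIn_of_getLast {l : List V} (hch : l.IsChain r) (hW : ∀ x ∈ l, x ∈ W)
    (hu : l.getLast? = some u) (hv : v ∈ l) : ReachIn r W v u := by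
  obtain ⟨s, t, rfl⟩ := List.append_of_mem hv
  refine reachIn_of_head (l := v :: t) (List.isChain_append.1 hch).2.1
    (fun x hx => hW x (List.mem_append_right _ hx)) (by simp) ?_
  have : (v :: t).getLast? = some u := by simpa [List.getLast?_append] using hu
  exact List.mem_of_getLast? this

lemma StrongOn.reachIn {S : Set V} (h : StrongOn r S) (hu : u ∈ S) (hv : v ∈ S) :
    ReachIn r S u v := by
  obtain ⟨l, ⟨⟨_, _, hch⟩, hS⟩, hhd, hlast⟩ := h u hu v hv
  exact reachIn_of_head hch hS hhd (List.mem_of_getLast? hlast)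

lemma strongOn_of_reachIn {S : Set V} (h : ∀ u ∈ S, ∀ v ∈ S, ReachIn r S u v) : StrongOn r S :=
  fun u hu v hv => (h u hu v hv).exists_dipathIn

/-- The vertices mutually reachable with a given one form a strong component. -/
lemma isStrongComponent_mutually_reachable (hu : u ∈ W) :
    IsStrongComponent r W {v | ReachIn r W u v ∧ ReachIn r W v u} := by
  refine ⟨fun v hv => hv.1.mem_right, ⟨u, .refl hu, .refl hu⟩, ?_, ?_⟩
  · refine strongOn_of_reachIn fun x hx y hy => ?_
    exact (hx.2.trans hy.1).restrict hx fun z hxz hzy => ⟨hx.1.trans hxz, hzy.trans hy.2⟩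
  · intro C' hC hC'W hC'
    refine Set.Subset.antisymm (fun x hx => ?_) hC
    have huC : u ∈ C' := hC ⟨.refl hu, .refl hu⟩
    exact ⟨(hC'.reachIn huC hx).mono (fun _ _ h => h) hC'W,
      (hC'.reachIn hx huC).mono (fun _ _ h => h) hC'W⟩

/-- A system of nonempty sets, each inside a strong component, shrinking as more vertices are
deleted, determines a haven. -/
lemma hasHavenOn_of_strong_cores {S : Set V} {k : ℕ} (G : Finset V → Set V)
    (hne : ∀ Z : Finset V, Z.card ≤ k → (G Z).Nonempty)
    (hreach : ∀ Z : Finset V, Z.card ≤ k → ∀ u ∈ G Z, ∀ v ∈ G Z, ReachIn r (S \ ↑Z) u v)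
    (hanti : ∀ Z' Z : Finset V, Z' ⊆ Z → G Z ⊆ G Z') : HasHavenOn r S (k + 1) := by
  refine ⟨fun Z => {v | ∃ u ∈ G Z, ReachIn r (S \ ↑Z) u v ∧ ReachIn r (S \ ↑Z) v u}, ?_⟩
  intro Z _ hZ
  have hZ : Z.card ≤ k := by omega
  constructor
  · obtain ⟨u, hu⟩ := hne Z hZ
    have h := isStrongComponent_mutually_reachable (r := r) (hreach Z hZ u hu u hu).1
    convert h using 1
    ext v
    constructor
    · rintro ⟨w, hw, h1, h2⟩
      exact ⟨(hreach Z hZ u hu w hw).trans h1, h2.trans (hreach Z hZ w hw u hu)⟩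
    · exact fun h => ⟨u, hu, h⟩
  · rintro Z' hZ' v ⟨u, hu, h1, h2⟩
    have hsub : S \ (Z : Set V) ⊆ S \ (Z' : Set V) :=
      Set.sdiff_subset_sdiff_right (by exact_mod_cast hZ')
    exact ⟨u, hanti _ _ hZ' hu, h1.mono (fun _ _ h => h) hsub, h2.mono (fun _ _ h => h) hsub⟩

end Reachability

section Balanced

variable {V : Type*} [Fintype V] [DecidableEq V] {m : V → V → ℕ}

/-- In a balanced multidigraph no edge enters an out-closed set from outside. -/
lemma mem_of_balanced (hbal : ∀ v, ∑ u, m u v = ∑ u, m v u) {R : Finset V}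
    (hR : ∀ u ∈ R, ∀ v, m u v ≠ 0 → v ∈ R) {u v : V} (hv : v ∈ R) (huv : m u v ≠ 0) : u ∈ R := by
  by_contra hu
  have h1 : ∑ v ∈ R, ∑ u, m u v = ∑ v ∈ R, ∑ u, m v u := Finset.sum_congr rfl fun v _ => hbal v
  have h2 : ∑ v ∈ R, ∑ u, m v u = ∑ v ∈ R, ∑ u ∈ R, m v u := by
    refine Finset.sum_congr rfl fun x hx => (Finset.sum_subset (Finset.subset_univ _) ?_).symm
    intro y _ hy
    by_contra h
    exact hy (hR x hx y h)
  have h3 : ∑ v ∈ R, ∑ u ∈ R, m u v < ∑ v ∈ R, ∑ u, m u v := by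
    refine Finset.sum_lt_sum (fun x _ => Finset.sum_le_sum_of_subset (Finset.subset_univ _))
      ⟨v, hv, ?_⟩
    exact Finset.sum_lt_sum_of_subset (Finset.subset_univ _) (Finset.mem_univ u) hu
      (Nat.pos_of_ne_zero huv) (fun _ _ _ => Nat.zero_le _)
  rw [h1, h2, Finset.sum_comm] at h3
  exact lt_irrefl _ h3

/-- A balanced multidigraph of small degree with a system of strongly connected cores contains
an eulerianizable subdigraph with a haven. -/
lemma exists_eulerianizable_of_balanced {A : V → V → Prop} {k d : ℕ}
    (hA : ∀ u v, m u v ≠ 0 → A u v) (hbal : ∀ v, ∑ u, m u v = ∑ u, m v u)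
    (hd : ∀ v, ∑ u, m v u ≤ d) (G : Finset V → Set V)
    (hne : ∀ Z : Finset V, Z.card ≤ k → (G Z).Nonempty)
    (hreach : ∀ Z : Finset V, Z.card ≤ k → ∀ u ∈ G Z, ∀ v ∈ G Z,
      ReachIn (fun x y => m x y ≠ 0) (↑Z)ᶜ u v)
    (hanti : ∀ Z' Z : Finset V, Z' ⊆ Z → G Z ⊆ G Z') :
    ∃ (S : Set V) (A' : V → V → Prop),
      IsSubdigraph A S A' ∧ Eulerianizable A' S d ∧ HasHavenOn A' S (k + 1) := by
  classical
  obtain ⟨o, ho⟩ := hne ∅ (by simp)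
  let r : V → V → Prop := fun x y => m x y ≠ 0
  have closed : ∀ x, ∀ u ∈ {v | ReachIn r Set.univ x v}, ∀ v, m u v ≠ 0 →
      v ∈ {v | ReachIn r Set.univ x v} :=
    fun x u hu v huv => ReachIn.trans hu (.single trivial trivial huv)
  have back : ∀ x u v, ReachIn r Set.univ x v → m u v ≠ 0 → ReachIn r Set.univ x u := by
    intro x u v hv huv
    have := mem_of_balanced hbal (R := Finset.univ.filter (fun v => ReachIn r Set.univ x v))
      (fun u hu v huv => by simpa using closed x u (by simpa using hu) v huv)
      (by simpa using hv) huv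
    simpa using this
  have symm : ∀ x y, ReachIn r Set.univ x y → ReachIn r Set.univ y x := by
    rintro x y ⟨_, h⟩
    induction h with
    | refl => exact .refl trivial
    | tail _ hbc ih => exact (back _ _ _ (.refl trivial) hbc.1).trans ih
  set S : Set V := {v | ReachIn r Set.univ o v} with hS
  let A' : V → V → Prop := fun u v => m u v ≠ 0 ∧ u ∈ S
  have lift : ∀ (T : Set V) u v, u ∈ S → ReachIn r T u v → ReachIn A' (S ∩ T) u v := by
    rintro T u v hu ⟨huT, h⟩
    induction h with
    | refl => exact .refl ⟨hu, huT⟩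
    | tail _ hbc ih =>
      exact ih.trans (.single ih.mem_right
        ⟨closed _ _ ih.mem_right.1 _ hbc.1, hbc.2⟩ ⟨hbc.1, ih.mem_right.1⟩)
  refine ⟨S, A', fun u v h => ⟨hA u v h.1, h.2, closed _ u h.2 v h.1⟩, ⟨?_, ?_⟩, ?_⟩
  · refine strongOn_of_reachIn fun u hu v hv => ?_
    simpa using lift Set.univ u v hu ((symm _ _ hu).trans hv)
  · refine ⟨fun u v => if u ∈ S then m u v else 0, ?_, ?_, ?_⟩
    · rintro u v ⟨h, hu⟩
      simpa [hu] using Nat.one_le_iff_ne_zero.2 h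
    · intro u v h
      by_contra h'
      by_cases hu : u ∈ S
      · exact h ⟨by simpa [hu] using h', hu⟩
      · exact h' (if_neg hu)
    · intro v hv
      have h1 : ∑ u, (if u ∈ S then m u v else 0) = ∑ u, m u v := by
        refine Finset.sum_congr rfl fun u _ => ?_
        split_ifs with hu
        · rfl
        · by_contra h
          exact hu (back _ u v hv (Ne.symm h))
      rw [h1]
      simp only [hv, if_true]
      exact ⟨hbal v, hd v⟩
  · have hGS : ∀ Z : Finset V, Z.card ≤ k → G Z ⊆ S := fun Z _ v hv =>
      (hreach ∅ (by simp) o ho v (hanti ∅ Z (Finset.empty_subset _) hv)).mono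
        (fun _ _ h => h) (Set.subset_univ _)
    refine hasHavenOn_of_strong_cores G hne (fun Z hZ u hu v hv => ?_) hanti
    exact lift _ u v (hGS Z hZ hu) (hreach Z hZ u hu v hv)

end Balanced
section Linkages

variable {V : Type*} {A : V → V → Prop} {S T : Finset V} {P : V → List V} {τ : V → V}

/-- The edges used by the paths of a linkage starting in `S`. -/
def LinkageEdge (S : Finset V) (P : V → List V) (u v : V) : Prop :=
  ∃ a ∈ S, [u, v] <:+: P a

lemma isChain_pair_infix (l : List V) : l.IsChain (fun u v => [u, v] <:+: l) := by
  suffices h : ∀ s t : List V, l = s ++ t → t.IsChain (fun u v => [u, v] <:+: l) from h [] l rfl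
  intro s t
  induction t generalizing s with
  | nil => intro _; exact List.isChain_nil
  | cons a t ih =>
    intro hl
    have h := ih (s ++ [a]) (by simpa using hl)
    cases t with
    | nil => exact List.isChain_singleton _
    | cons b t => exact List.isChain_cons_cons.2 ⟨⟨s, t, by simp [hl]⟩, h⟩

lemma eq_of_pair_infix_of_nodup {l : List V} (hl : l.Nodup) {u v w : V}
    (hv : [u, v] <:+: l) (hw : [u, w] <:+: l) : v = w := by
  obtain ⟨s, t, rfl⟩ := hv
  obtain ⟨s', t', h⟩ := hw
  simp only [List.append_assoc, List.cons_append, List.nil_append] at h hl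
  rw [← h] at hl
  have hns : u ∉ s' := fun hu => (List.nodup_append.1 hl).2.2 u hu u (by simp) rfl
  have hnt : u ∉ w :: t' := (List.nodup_cons.1 (List.nodup_append.1 hl).2.1).1
  have := (List.append_cons_inj_of_notMem hns hnt).1 h
  simp at this
  exact this.2.1.symm

lemma eq_of_pair_infix_of_nodup' {l : List V} (hl : l.Nodup) {u v w : V}
    (hv : [v, u] <:+: l) (hw : [w, u] <:+: l) : v = w := by
  refine eq_of_pair_infix_of_nodup (List.nodup_reverse.2 hl) (u := u) ?_ ?_
  · simpa using List.reverse_infix.2 hv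
  · simpa using List.reverse_infix.2 hw

lemma exists_pair_infix_iff {l : List V} (hl : l.Nodup) {u b : V} (hb : l.getLast? = some b) :
    (∃ v, [u, v] <:+: l) ↔ u ∈ l ∧ u ≠ b := by
  constructor
  · rintro ⟨v, s, t, rfl⟩
    refine ⟨by simp, ?_⟩
    rintro rfl
    have hlast : u ∈ v :: t := by
      have : (v :: t).getLast? = some u := by simpa [List.getLast?_append] using hb
      exact List.mem_of_getLast? this
    simp only [List.append_assoc, List.cons_append, List.nil_append] at hl
    exact (List.nodup_cons.1 (List.nodup_append.1 hl).2.1).1 hlast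
  · rintro ⟨hu, hub⟩
    obtain ⟨s, t, rfl⟩ := List.append_of_mem hu
    cases t with
    | nil => simp at hb; exact absurd hb hub
    | cons v t => exact ⟨v, s, t, by simp⟩

lemma exists_pair_infix_iff' {l : List V} (hl : l.Nodup) {u a : V} (ha : l.head? = some a) :
    (∃ v, [v, u] <:+: l) ↔ u ∈ l ∧ u ≠ a := by
  have := exists_pair_infix_iff (List.nodup_reverse.2 hl) (u := u) (b := a) (by simpa using ha)
  rw [List.mem_reverse] at this
  rw [← this]
  refine exists_congr fun v => ?_
  rw [← List.reverse_infix]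
  simp

lemma IsLinkage.injOn (h : IsLinkage A S T P τ) : Set.InjOn τ ↑S := by
  intro a ha b hb hab
  by_contra hne
  refine h.2 a ha b hb hne (τ a) (List.mem_of_getLast? (h.1 a ha).2.2.2) ?_
  rw [hab]
  exact List.mem_of_getLast? (h.1 b hb).2.2.2

lemma IsLinkage.eq_of_mem (h : IsLinkage A S T P τ) {a b v : V} (ha : a ∈ S) (hb : b ∈ S)
    (hva : v ∈ P a) (hvb : v ∈ P b) : a = b := by
  by_contra hne
  exact h.2 a ha b hb hne v hva hvb

lemma IsLinkage.exists_eq (h : IsLinkage A S T P τ) (hcard : S.card = T.card) {b : V}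
    (hb : b ∈ T) : ∃ a ∈ S, τ a = b :=
  Finset.surjOn_of_injOn_of_card_le τ (fun a ha => (h.1 a ha).1) h.injOn hcard.ge hb

lemma IsLinkage.restrict [DecidableEq V] (h : IsLinkage A S T P τ) {S' : Finset V}
    (hS : S' ⊆ S) : IsLinkage A S' (S'.image τ) P τ :=
  ⟨fun a ha => ⟨Finset.mem_image_of_mem τ ha, (h.1 a (hS ha)).2⟩,
    fun a ha b hb => h.2 a (hS ha) b (hS hb)⟩

lemma IsLinkage.card_image [DecidableEq V] (h : IsLinkage A S T P τ) {S' : Finset V}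
    (hS : S' ⊆ S) : (S'.image τ).card = S'.card :=
  Finset.card_image_of_injOn (h.injOn.mono (by exact_mod_cast hS))

lemma IsLinkage.image_subset [DecidableEq V] (h : IsLinkage A S T P τ) {S' : Finset V}
    (hS : S' ⊆ S) : S'.image τ ⊆ T := by
  intro b hb
  obtain ⟨a, ha, rfl⟩ := Finset.mem_image.1 hb
  exact (h.1 a (hS ha)).1

lemma IsLinkage.head_mem (h : IsLinkage A S T P τ) {a : V} (ha : a ∈ S) : a ∈ P a :=
  List.mem_of_mem_head? (h.1 a ha).2.2.1

lemma IsLinkage.last_mem (h : IsLinkage A S T P τ) {a : V} (ha : a ∈ S) : τ a ∈ P a :=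
  List.mem_of_getLast? (h.1 a ha).2.2.2

lemma IsLinkage.reachIn_head (h : IsLinkage A S T P τ) {r : V → V → Prop} {W : Set V}
    (hr : ∀ u v, LinkageEdge S P u v → r u v) {a v : V} (ha : a ∈ S) (hW : ∀ x ∈ P a, x ∈ W)
    (hv : v ∈ P a) : ReachIn r W a v :=
  (reachIn_of_head (isChain_pair_infix (P a)) hW (h.1 a ha).2.2.1 hv).mono
    (fun _ _ hxy => hr _ _ ⟨a, ha, hxy⟩) subset_rfl

lemma IsLinkage.reachIn_last (h : IsLinkage A S T P τ) {r : V → V → Prop} {W : Set V}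
    (hr : ∀ u v, LinkageEdge S P u v → r u v) {a v : V} (ha : a ∈ S) (hW : ∀ x ∈ P a, x ∈ W)
    (hv : v ∈ P a) : ReachIn r W v (τ a) :=
  (reachIn_of_getLast (isChain_pair_infix (P a)) hW (h.1 a ha).2.2.2 hv).mono
    (fun _ _ hxy => hr _ _ ⟨a, ha, hxy⟩) subset_rfl

lemma IsLinkage.adj (h : IsLinkage A S T P τ) {u v : V} (huv : LinkageEdge S P u v) : A u v := by
  obtain ⟨a, ha, hi⟩ := huv
  have := List.IsChain.infix (h.1 a ha).2.1.2.2 hi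
  simpa using this

lemma IsLinkage.exists_edge_iff (h : IsLinkage A S T P τ) (hcard : S.card = T.card) (v : V) :
    (∃ u, LinkageEdge S P v u) ↔ (∃ a ∈ S, v ∈ P a) ∧ v ∉ T := by
  constructor
  · rintro ⟨u, a, ha, hi⟩
    obtain ⟨hv, hne⟩ := (exists_pair_infix_iff (h.1 a ha).2.1.2.1 (h.1 a ha).2.2.2).1 ⟨u, hi⟩
    refine ⟨⟨a, ha, hv⟩, fun hvT => ?_⟩
    obtain ⟨b, hb, rfl⟩ := h.exists_eq hcard hvT
    exact hne (congrArg τ (h.eq_of_mem hb ha (h.last_mem hb) hv))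
  · rintro ⟨⟨a, ha, hv⟩, hvT⟩
    obtain ⟨u, hu⟩ := (exists_pair_infix_iff (h.1 a ha).2.1.2.1 (h.1 a ha).2.2.2).2
      ⟨hv, fun hva => hvT (hva ▸ (h.1 a ha).1)⟩
    exact ⟨u, a, ha, hu⟩

lemma IsLinkage.exists_edge_iff' (h : IsLinkage A S T P τ) (v : V) :
    (∃ u, LinkageEdge S P u v) ↔ (∃ a ∈ S, v ∈ P a) ∧ v ∉ S := by
  constructor
  · rintro ⟨u, a, ha, hi⟩
    obtain ⟨hv, hne⟩ := (exists_pair_infix_iff' (h.1 a ha).2.1.2.1 (h.1 a ha).2.2.1).1 ⟨u, hi⟩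
    exact ⟨⟨a, ha, hv⟩, fun hvS => hne (h.eq_of_mem hvS ha (h.head_mem hvS) hv)⟩
  · rintro ⟨⟨a, ha, hv⟩, hvS⟩
    obtain ⟨u, hu⟩ := (exists_pair_infix_iff' (h.1 a ha).2.1.2.1 (h.1 a ha).2.2.1).2
      ⟨hv, fun hva => hvS (hva ▸ ha)⟩
    exact ⟨u, a, ha, hu⟩

lemma mem_of_pair_infix {l : List V} {u v : V} (h : [u, v] <:+: l) : u ∈ l ∧ v ∈ l :=
  ⟨h.subset (by simp), h.subset (by simp)⟩

open Classical in
lemma sum_indicator_eq [Fintype V] {p : V → Prop} {q : Prop} [Decidable q] (hq : (∃ u, p u) ↔ q)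
    (huniq : ∀ u w, p u → p w → u = w) :
    (∑ u, if p u then 1 else 0) = if q then 1 else 0 := by
  by_cases h : ∃ u, p u
  · obtain ⟨u, hu⟩ := h
    have : ∀ w, p w ↔ w = u := fun w => ⟨fun hw => huniq w u hw hu, fun hw => hw ▸ hu⟩
    rw [if_pos (hq.1 ⟨u, hu⟩)]
    simp [this]
  · rw [if_neg fun h' => h (hq.2 h')]
    push Not at h
    simp [h]

open Classical in
lemma IsLinkage.sum_out [Fintype V] (h : IsLinkage A S T P τ) (hcard : S.card = T.card) (v : V) :
    (∑ u, if LinkageEdge S P v u then 1 else 0) =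
      if (∃ a ∈ S, v ∈ P a) ∧ v ∉ T then 1 else 0 := by
  refine sum_indicator_eq (h.exists_edge_iff hcard v) ?_
  rintro u w ⟨a, ha, hu⟩ ⟨b, hb, hw⟩
  obtain rfl := h.eq_of_mem ha hb (mem_of_pair_infix hu).1 (mem_of_pair_infix hw).1
  exact eq_of_pair_infix_of_nodup (h.1 a ha).2.1.2.1 hu hw

open Classical in
lemma IsLinkage.sum_in [Fintype V] (h : IsLinkage A S T P τ) (v : V) :
    (∑ u, if LinkageEdge S P u v then 1 else 0) =
      if (∃ a ∈ S, v ∈ P a) ∧ v ∉ S then 1 else 0 := by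
  refine sum_indicator_eq (h.exists_edge_iff' v) ?_
  rintro u w ⟨a, ha, hu⟩ ⟨b, hb, hw⟩
  obtain rfl := h.eq_of_mem ha hb (mem_of_pair_infix hu).2 (mem_of_pair_infix hw).2
  exact eq_of_pair_infix_of_nodup' (h.1 a ha).2.1.2.1 hu hw

open Classical in
/-- The multiplicity with which an edge is used by two linkages, one from `S` to `T` and one
from `T` to `S`. -/
noncomputable def circuitMult (S T : Finset V) (P Q : V → List V) (u v : V) : ℕ :=
  (if LinkageEdge S P u v then 1 else 0) + (if LinkageEdge T Q u v then 1 else 0)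

variable {Q : V → List V} {σ : V → V}

lemma circuitMult_ne_zero {u v : V} :
    circuitMult S T P Q u v ≠ 0 ↔ LinkageEdge S P u v ∨ LinkageEdge T Q u v := by
  unfold circuitMult
  split_ifs <;> simp_all

lemma circuitMult_balanced [Fintype V] (hP : IsLinkage A S T P τ) (hQ : IsLinkage A T S Q σ)
    (hcard : S.card = T.card) (v : V) :
    ∑ u, circuitMult S T P Q u v = ∑ u, circuitMult S T P Q v u := by
  unfold circuitMult
  rw [Finset.sum_add_distrib, Finset.sum_add_distrib, hP.sum_in, hQ.sum_in, hP.sum_out hcard,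
    hQ.sum_out hcard.symm]
  by_cases hS : v ∈ S <;> by_cases hT : v ∈ T
  · simp [hS, hT]
  · have h1 : ∃ a ∈ S, v ∈ P a := ⟨v, hS, hP.head_mem hS⟩
    obtain ⟨b, hb, rfl⟩ := hQ.exists_eq hcard.symm hS
    have h2 : ∃ a ∈ T, σ b ∈ Q a := ⟨b, hb, hQ.last_mem hb⟩
    simp only [hS, hT, h1, h2]
    simp
  · have h1 : ∃ a ∈ T, v ∈ Q a := ⟨v, hT, hQ.head_mem hT⟩
    obtain ⟨b, hb, rfl⟩ := hP.exists_eq hcard hT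
    have h2 : ∃ a ∈ S, τ b ∈ P a := ⟨b, hb, hP.last_mem hb⟩
    simp only [hS, hT, h1, h2]
    simp
  · by_cases h1 : ∃ a ∈ S, v ∈ P a <;> by_cases h2 : ∃ a ∈ T, v ∈ Q a <;>
      simp only [hS, hT, h1, h2]

lemma circuitMult_out_le [Fintype V] (hP : IsLinkage A S T P τ) (hQ : IsLinkage A T S Q σ)
    (hcard : S.card = T.card) (v : V) : ∑ u, circuitMult S T P Q v u ≤ 2 := by
  unfold circuitMult
  rw [Finset.sum_add_distrib, hP.sum_out hcard, hQ.sum_out hcard.symm]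
  split_ifs <;> simp

/-- Two pairs of opposite linkages together with a system of strongly connected cores yield a
`4`-eulerianizable subdigraph with a haven. -/
lemma exists_eulerianizable_of_linkages [Fintype V] [DecidableEq V] {k : ℕ}
    {S' T' : Finset V} {P' Q' : V → List V} {τ' σ' : V → V}
    (hP : IsLinkage A S T P τ) (hQ : IsLinkage A T S Q σ) (hcard : S.card = T.card)
    (hP' : IsLinkage A S' T' P' τ') (hQ' : IsLinkage A T' S' Q' σ') (hcard' : S'.card = T'.card)
    (G : Finset V → Set V)
    (hne : ∀ Z : Finset V, Z.card ≤ k → (G Z).Nonempty)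
    (hreach : ∀ (r : V → V → Prop),
      (∀ u v, LinkageEdge S P u v → r u v) → (∀ u v, LinkageEdge T Q u v → r u v) →
      (∀ u v, LinkageEdge S' P' u v → r u v) → (∀ u v, LinkageEdge T' Q' u v → r u v) →
      ∀ Z : Finset V, Z.card ≤ k → ∀ u ∈ G Z, ∀ v ∈ G Z, ReachIn r (↑Z)ᶜ u v)
    (hanti : ∀ Z' Z : Finset V, Z' ⊆ Z → G Z ⊆ G Z') :
    ∃ (S : Set V) (A' : V → V → Prop),
      IsSubdigraph A S A' ∧ Eulerianizable A' S 4 ∧ HasHavenOn A' S (k + 1) := by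
  have hm : ∀ u v, circuitMult S T P Q u v + circuitMult S' T' P' Q' u v ≠ 0 ↔
      (LinkageEdge S P u v ∨ LinkageEdge T Q u v) ∨
        (LinkageEdge S' P' u v ∨ LinkageEdge T' Q' u v) := by
    intro u v
    rw [← circuitMult_ne_zero, ← circuitMult_ne_zero]
    omega
  refine exists_eulerianizable_of_balanced
    (m := fun u v => circuitMult S T P Q u v + circuitMult S' T' P' Q' u v)
    (fun u v h => ?_) (fun v => ?_) (fun v => ?_) G hne ?_ hanti
  · rcases (hm u v).1 h with (h | h) | (h | h)
    exacts [hP.adj h, hQ.adj h, hP'.adj h, hQ'.adj h]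
  · rw [Finset.sum_add_distrib, Finset.sum_add_distrib, circuitMult_balanced hP hQ hcard,
      circuitMult_balanced hP' hQ' hcard']
  · rw [Finset.sum_add_distrib]
    have := circuitMult_out_le hP hQ hcard v
    have := circuitMult_out_le hP' hQ' hcard' v
    omega
  · refine hreach _ ?_ ?_ ?_ ?_ <;> intro u v h <;> rw [hm] <;> tauto

end Linkages

section Extremal

/-- If each of `d` relations lets an element of `Z` block at most one element of `K`, and `K` has
more than `|Z| * d` elements, then some element of `K` is not blocked at all. -/
lemma exists_forall_not_of_functional {α β : Type*} {d : ℕ} {Z : Finset α} {K : Finset β}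
    (r : Fin d → α → β → Prop) (hr : ∀ i, ∀ z ∈ Z, ∀ k ∈ K, ∀ k' ∈ K, r i z k → r i z k' → k = k')
    (hcard : Z.card * d < K.card) : ∃ k ∈ K, ∀ i, ∀ z ∈ Z, ¬ r i z k := by
  by_contra! h
  obtain ⟨k₀, hk₀⟩ : K.Nonempty := Finset.card_pos.1 (by omega)
  obtain ⟨i₀, z₀, -⟩ := h k₀ hk₀
  have : Nonempty (Fin d) := ⟨i₀⟩
  have : Nonempty α := ⟨z₀⟩
  choose! i z hz hi using h
  refine hcard.not_ge ?_
  have : (Z ×ˢ (Finset.univ : Finset (Fin d))).card = Z.card * d := by simp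
  rw [← this]
  refine Finset.card_le_card_of_injOn (fun k => (z k, i k)) (fun k hk => ?_) ?_
  · simpa using hz k hk
  · intro k hk k' hk' hkk
    simp only [Prod.mk.injEq] at hkk
    refine hr (i k) (z k) (hz k hk) k hk k' hk' (hi k hk) ?_
    rw [hkk.1, hkk.2]
    exact hi k' hk'

/-- Ramsey's theorem for graphs. -/
lemma exists_ramsey (s t : ℕ) : ∃ c : ℕ, ∀ {α : Type} (r : α → α → Prop),
    (∀ x y, r x y → r y x) → ∀ F : Finset α, c ≤ F.card →
    (∃ S ⊆ F, S.card = s ∧ ∀ x ∈ S, ∀ y ∈ S, x ≠ y → r x y) ∨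
    (∃ S ⊆ F, S.card = t ∧ ∀ x ∈ S, ∀ y ∈ S, x ≠ y → ¬ r x y) := by
  classical
  induction s generalizing t with
  | zero => exact ⟨0, fun r _ F _ => .inl ⟨∅, by simp⟩⟩
  | succ s ihs =>
    induction t with
    | zero => exact ⟨0, fun r _ F _ => .inr ⟨∅, by simp⟩⟩
    | succ t iht =>
      obtain ⟨c₁, h₁⟩ := ihs (t + 1)
      obtain ⟨c₂, h₂⟩ := iht
      refine ⟨c₁ + c₂ + 1, fun {α} r hr F hF => ?_⟩
      obtain ⟨x, hx⟩ : F.Nonempty := Finset.card_pos.1 (by omega)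
      have hsplit := Finset.card_filter_add_card_filter_not (s := F.erase x) (r x)
      rw [Finset.card_erase_of_mem hx] at hsplit
      have hsub : ∀ (p : α → Prop) [DecidablePred p],
          ∀ S ⊆ (F.erase x).filter p, S ⊆ F ∧ x ∉ S ∧ ∀ y ∈ S, p y :=
        fun p _ S hS => ⟨fun y hy => Finset.mem_of_mem_erase (Finset.mem_filter.1 (hS hy)).1,
          fun hxS => by simpa using hS hxS, fun y hy => (Finset.mem_filter.1 (hS hy)).2⟩
      by_cases hc : c₁ ≤ ((F.erase x).filter (r x)).card
      · rcases h₁ r hr _ hc with ⟨S, hS, hcard, h⟩ | ⟨S, hS, hcard, h⟩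
        · obtain ⟨hSF, hxS, hrS⟩ := hsub _ S hS
          refine .inl ⟨insert x S, Finset.insert_subset hx hSF, by simp [hxS, hcard], ?_⟩
          simp only [Finset.mem_insert]
          rintro y (rfl | hy) z (rfl | hz) hne
          exacts [absurd rfl hne, hrS z hz, hr _ _ (hrS y hy), h y hy z hz hne]
        · exact .inr ⟨S, (hsub _ S hS).1, hcard, h⟩
      · rcases h₂ r hr ((F.erase x).filter (fun y => ¬ r x y)) (by omega) with
          ⟨S, hS, hcard, h⟩ | ⟨S, hS, hcard, h⟩
        · exact .inl ⟨S, (hsub _ S hS).1, hcard, h⟩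
        · obtain ⟨hSF, hxS, hrS⟩ := hsub _ S hS
          refine .inr ⟨insert x S, Finset.insert_subset hx hSF, by simp [hxS, hcard], ?_⟩
          simp only [Finset.mem_insert]
          rintro y (rfl | hy) z (rfl | hz) hne
          exacts [absurd rfl hne, hrS z hz, fun hyx => hrS y hy (hr _ _ hyx), h y hy z hz hne]

/-- Ramsey's theorem for bipartite graphs. -/
lemma exists_bipartite_ramsey (k : ℕ) : ∃ M : ℕ, ∀ {α : Type} (r : α → α → Prop)
    (U W : Finset α), M ≤ U.card → M ≤ W.card →
    ∃ U' ⊆ U, ∃ W' ⊆ W, U'.card = k ∧ W'.card = k ∧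
      ((∀ u ∈ U', ∀ w ∈ W', r u w) ∨ (∀ u ∈ U', ∀ w ∈ W', ¬ r u w)) := by
  classical
  refine ⟨2 * k + 2 ^ (2 * k) * k, fun {α} r U W hU hW => ?_⟩
  obtain ⟨J, hJU, hJ⟩ := Finset.exists_subset_card_eq (le_trans (Nat.le_add_right _ _) hU)
  obtain ⟨Y, hY, hYcard⟩ := Finset.exists_le_card_fiber_of_mul_le_card_of_maps_to
    (s := W) (t := J.powerset) (n := k) (f := fun w => J.filter (fun u => r u w))
    (fun w _ => Finset.mem_powerset.2 (Finset.filter_subset _ _)) ⟨∅, by simp⟩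
    (by rw [Finset.card_powerset, hJ]; omega)
  obtain ⟨W', hW', hW'card⟩ := Finset.exists_subset_card_eq hYcard
  have hYJ := Finset.mem_powerset.1 hY
  have hrel : ∀ w ∈ W', ∀ u ∈ J, r u w ↔ u ∈ Y := fun w hw u hu => by
    rw [← (Finset.mem_filter.1 (hW' hw)).2]
    simp [hu]
  have hW'W : W' ⊆ W := fun w hw => (Finset.mem_filter.1 (hW' hw)).1
  by_cases hc : k ≤ Y.card
  · obtain ⟨U', hU', hU'card⟩ := Finset.exists_subset_card_eq hc
    exact ⟨U', (hU'.trans hYJ).trans hJU, W', hW'W, hU'card, hW'card,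
      .inl fun u hu w hw => (hrel w hw u (hYJ (hU' hu))).2 (hU' hu)⟩
  · have := Finset.card_sdiff_add_card_eq_card hYJ
    obtain ⟨U', hU', hU'card⟩ := Finset.exists_subset_card_eq (s := J \ Y) (n := k) (by omega)
    have hmem : ∀ u ∈ U', u ∈ J ∧ u ∉ Y := fun u hu => Finset.mem_sdiff.1 (hU' hu)
    exact ⟨U', fun u hu => hJU (hmem u hu).1, W', hW'W, hU'card, hW'card,
      .inr fun u hu w hw h => (hmem u hu).2 ((hrel w hw u (hmem u hu).1).1 h)⟩

/-- In large families, either two of them contain large completely conflicting subfamilies, or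
all can be thinned out so that prescribed pairs of families do not conflict. -/
lemma exists_thinning {ι : Type} [DecidableEq ι] (g : ℕ) (E : Finset (ι × ι))
    (hE : ∀ e ∈ E, e.1 ≠ e.2) (t : ℕ) :
    ∃ M : ℕ, ∀ {α : Type} (conf : ι → ι → α → α → Prop) (U : ι → Finset α),
      (∀ i, M ≤ (U i).card) →
      (∃ i j, i ≠ j ∧ ∃ S ⊆ U i, ∃ T ⊆ U j, S.card = g ∧ T.card = g ∧
        ∀ u ∈ S, ∀ v ∈ T, conf i j u v) ∨
      (∃ U' : ι → Finset α, (∀ i, U' i ⊆ U i ∧ t ≤ (U' i).card) ∧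
        ∀ e ∈ E, ∀ u ∈ U' e.1, ∀ v ∈ U' e.2, ¬ conf e.1 e.2 u v) := by
  induction E using Finset.induction_on generalizing t with
  | empty => exact ⟨t, fun conf U hU => .inr ⟨U, fun i => ⟨subset_rfl, hU i⟩, by simp⟩⟩
  | insert e E heE ih =>
    obtain ⟨M₁, h₁⟩ := exists_bipartite_ramsey (max t g)
    obtain ⟨M, h⟩ := ih (fun e' he' => hE e' (Finset.mem_insert_of_mem he')) (max t M₁)
    have hne := hE e (Finset.mem_insert_self _ _)
    refine ⟨M, fun {α} conf U hU => ?_⟩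
    rcases h conf U hU with h | ⟨U', hU', hconf⟩
    · exact .inl h
    obtain ⟨S, hS, T, hT, hScard, hTcard, hall | hnone⟩ := h₁ (conf e.1 e.2) (U' e.1) (U' e.2)
      (le_trans (le_max_right _ _) (hU' _).2) (le_trans (le_max_right _ _) (hU' _).2)
    · left
      obtain ⟨S', hS', hS'card⟩ := Finset.exists_subset_card_eq (s := S) (n := g)
        (hScard ▸ le_max_right _ _)
      obtain ⟨T', hT', hT'card⟩ := Finset.exists_subset_card_eq (s := T) (n := g)
        (hTcard ▸ le_max_right _ _)
      exact ⟨e.1, e.2, hne, S', (hS'.trans hS).trans (hU' _).1, T', (hT'.trans hT).trans (hU' _).1,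
        hS'card, hT'card, fun u hu v hv => hall u (hS' hu) v (hT' hv)⟩
    · right
      let U'' : ι → Finset α := Function.update (Function.update U' e.1 S) e.2 T
      have h1 : U'' e.1 = S := by simp [U'', Function.update_of_ne hne]
      have h2 : U'' e.2 = T := by simp [U'']
      have h3 : ∀ i, U'' i ⊆ U' i ∧ t ≤ (U'' i).card := by
        intro i
        rcases eq_or_ne i e.2 with rfl | hi2
        · rw [h2]
          exact ⟨hT, hTcard ▸ le_max_left _ _⟩
        rcases eq_or_ne i e.1 with rfl | hi1
        · rw [h1]
          exact ⟨hS, hScard ▸ le_max_left _ _⟩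
        · have : U'' i = U' i := by simp [U'', hi1, hi2]
          rw [this]
          exact ⟨subset_rfl, le_trans (le_max_left _ _) (hU' i).2⟩
      refine ⟨U'', fun i => ⟨(h3 i).1.trans (hU' i).1, (h3 i).2⟩, fun e' he' => ?_⟩
      rcases Finset.mem_insert.1 he' with rfl | he'
      · rw [h1, h2]
        exact hnone
      · exact fun u hu v hv => hconf e' he' u ((h3 _).1 hu) v ((h3 _).1 hv)

/-- In large families, either two of them contain large completely conflicting subfamilies, or
there is a transversal without conflicts. -/
lemma exists_transversal (ι : Type) [Fintype ι] (g : ℕ) :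
    ∃ M : ℕ, ∀ {α : Type} (conf : ι → ι → α → α → Prop) (U : ι → Finset α),
      (∀ i, M ≤ (U i).card) →
      (∃ i j, i ≠ j ∧ ∃ S ⊆ U i, ∃ T ⊆ U j, S.card = g ∧ T.card = g ∧
        ∀ u ∈ S, ∀ v ∈ T, conf i j u v) ∨
      (∃ x : ι → α, (∀ i, x i ∈ U i) ∧ ∀ i j, i ≠ j → ¬ conf i j (x i) (x j)) := by
  classical
  obtain ⟨M, h⟩ := exists_thinning g ((Finset.univ : Finset (ι × ι)).filter (fun e => e.1 ≠ e.2))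
    (by simp) 1
  refine ⟨M, fun {α} conf U hU => ?_⟩
  rcases h conf U hU with h | ⟨U', hU', hconf⟩
  · exact .inl h
  · have hne : ∀ i, ∃ x, x ∈ U' i := fun i => Finset.card_pos.1 (hU' i).2
    choose x hx using hne
    exact .inr ⟨x, fun i => (hU' i).1 (hx i),
      fun i j hij => hconf (i, j) (by simpa using hij) _ (hx i) _ (hx j)⟩

end Extremal

section Grid

variable {V : Type*} {A : V → V → Prop} {S T : Finset V} {P R : V → List V} {τ ρ : V → V}

lemma IsLinkage.exists_avoiding (hP : IsLinkage A S T P τ) (hR : IsLinkage A T S R ρ)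
    {Z : Finset V} (hZ : Z.card * 3 < S.card) :
    ∃ c ∈ S, (∀ x ∈ P c, x ∈ (↑Z : Set V)ᶜ) ∧ (∀ x ∈ R (τ c), x ∈ (↑Z : Set V)ᶜ) ∧
      (∀ x ∈ P (ρ (τ c)), x ∈ (↑Z : Set V)ᶜ) := by
  have hτ : ∀ c ∈ S, τ c ∈ T := fun c hc => (hP.1 c hc).1
  have hρ : ∀ c ∈ T, ρ c ∈ S := fun c hc => (hR.1 c hc).1
  obtain ⟨c, hc, h⟩ := exists_forall_not_of_functional (Z := Z) (K := S)
    ![fun z c => z ∈ P c, fun z c => z ∈ R (τ c), fun z c => z ∈ P (ρ (τ c))] (by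
      intro i z _ k hk k' hk'
      fin_cases i
      · exact fun h h' => hP.eq_of_mem hk hk' h h'
      · exact fun h h' => hP.injOn hk hk' (hR.eq_of_mem (hτ k hk) (hτ k' hk') h h')
      · exact fun h h' => hP.injOn hk hk' (hR.injOn (hτ k hk) (hτ k' hk')
          (hP.eq_of_mem (hρ _ (hτ k hk)) (hρ _ (hτ k' hk')) h h'))) hZ
  exact ⟨c, hc, fun x hx hxZ => h 0 x hxZ hx, fun x hx hxZ => h 1 x hxZ hx,
    fun x hx hxZ => h 2 x hxZ hx⟩

/-- Two linkages with ends in a linked set, every path of one meeting every path of the other,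
give an eulerianizable subdigraph with a haven. -/
lemma exists_eulerianizable_of_grid [Fintype V] [DecidableEq V] {X : Finset V} {n : ℕ}
    (hX : Linked A X) {S' T' : Finset V} {P' : V → List V} {τ' : V → V}
    (hP : IsLinkage A S T P τ) (hP' : IsLinkage A S' T' P' τ')
    (hS : S ⊆ X) (hT : T ⊆ X) (hS' : S' ⊆ X) (hT' : T' ⊆ X)
    (hST : S.card = T.card) (hST' : S'.card = T'.card)
    (hn : n * 3 < S.card) (hn' : n * 3 < S'.card)
    (hmeet : ∀ a ∈ S, ∀ b ∈ S', ∃ v ∈ P a, v ∈ P' b) :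
    ∃ (S : Set V) (A' : V → V → Prop),
      IsSubdigraph A S A' ∧ Eulerianizable A' S 4 ∧ HasHavenOn A' S (n + 1) := by
  obtain ⟨R, ρ, hR⟩ := hX T S hT hS hST.symm
  obtain ⟨R', ρ', hR'⟩ := hX T' S' hT' hS' hST'.symm
  have hτ : ∀ c ∈ S, τ c ∈ T := fun c hc => (hP.1 c hc).1
  have hρ : ∀ c ∈ T, ρ c ∈ S := fun c hc => (hR.1 c hc).1
  have hτ' : ∀ c ∈ S', τ' c ∈ T' := fun c hc => (hP'.1 c hc).1
  have hρ' : ∀ c ∈ T', ρ' c ∈ S' := fun c hc => (hR'.1 c hc).1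
  refine exists_eulerianizable_of_linkages hP hR hST hP' hR' hST'
    (fun Z => {v | ∃ c ∈ S, v = ρ (τ c) ∧ (∀ x ∈ P c, x ∈ (↑Z : Set V)ᶜ) ∧
      (∀ x ∈ R (τ c), x ∈ (↑Z : Set V)ᶜ) ∧ (∀ x ∈ P (ρ (τ c)), x ∈ (↑Z : Set V)ᶜ)}) ?_ ?_ ?_
  · intro Z hZ
    obtain ⟨c, hc, h⟩ := hP.exists_avoiding hR (Z := Z) (by omega)
    exact ⟨_, c, hc, rfl, h⟩
  · rintro r hr₁ hr₂ hr₃ hr₄ Z hZ _ ⟨b, hb, rfl, -, -, h₃⟩ _ ⟨c, hc, rfl, h₁, h₂, -⟩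
    obtain ⟨d, hd, h₁', h₂', h₃'⟩ := hP'.exists_avoiding hR' (Z := Z) (by omega)
    obtain ⟨x, hx, hx'⟩ := hmeet _ (hρ _ (hτ b hb)) d hd
    obtain ⟨y, hy, hy'⟩ := hmeet c hc _ (hρ' _ (hτ' d hd))
    exact (hP.reachIn_head hr₁ (hρ _ (hτ b hb)) h₃ hx).trans <|
      (hP'.reachIn_last hr₃ hd h₁' hx').trans <|
      (hR'.reachIn_head hr₄ (hτ' d hd) h₂' (hR'.last_mem (hτ' d hd))).trans <|
      (hP'.reachIn_head hr₃ (hρ' _ (hτ' d hd)) h₃' hy').trans <|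
      (hP.reachIn_last hr₁ hc h₁ hy).trans <|
      hR.reachIn_head hr₂ (hτ c hc) h₂ (hR.last_mem (hτ c hc))
  · rintro Z' Z hZ v ⟨c, hc, hv, h₁, h₂, h₃⟩
    have hsub : (↑Z : Set V)ᶜ ⊆ (↑Z' : Set V)ᶜ :=
      Set.compl_subset_compl.2 (by exact_mod_cast hZ)
    exact ⟨c, hc, hv, fun x hx => hsub (h₁ x hx), fun x hx => hsub (h₂ x hx),
      fun x hx => hsub (h₃ x hx)⟩

end Grid

section Orbits

open Function

variable {V : Type*} {S : Finset V} {f : V → V}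

lemma mem_periodicPts_of_injOn (hmaps : Set.MapsTo f ↑S ↑S) (hinj : Set.InjOn f ↑S) {x : V}
    (hx : x ∈ S) : x ∈ periodicPts f := by
  have hinj' : Injective (hmaps.restrict f ↑S ↑S) := hmaps.restrict_inj.2 hinj
  obtain ⟨p, hp, h⟩ := hinj'.mem_periodicPts ⟨x, hx⟩
  refine ⟨p, hp, ?_⟩
  have hit := congrArg Subtype.val h
  rwa [hmaps.iterate_restrict] at hit

/-- Merging iterates of periodic points force the points to lie on the same orbit. -/
lemma exists_iterate_eq_of_iterate_eq {x y : V} (hy : y ∈ periodicPts f) {k l : ℕ}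
    (h : f^[k] x = f^[l] y) : ∃ j, f^[j] x = y := by
  obtain ⟨p, hp, hper⟩ := hy
  have hle : l ≤ l * p := Nat.le_mul_of_pos_right l hp
  refine ⟨(l * p - l) + k, ?_⟩
  rw [iterate_add_apply, h, ← iterate_add_apply, Nat.sub_add_cancel hle]
  exact hper.const_mul l

/-- A large permuted set has a long orbit or meets many orbits. -/
lemma exists_long_orbit_or_many_orbits (hmaps : Set.MapsTo f ↑S ↑S) (hinj : Set.InjOn f ↑S)
    {L c : ℕ} (hL : 0 < L) (hcard : L * c ≤ S.card) :
    (∃ x ∈ S, L ≤ minimalPeriod f x) ∨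
    (∃ F ⊆ S, c ≤ F.card ∧ ∀ x ∈ F, ∀ y ∈ F, ∀ k l, f^[k] x = f^[l] y → x = y) := by
  classical
  by_contra! hcon
  obtain ⟨hper, hF⟩ := hcon
  have hperiodic : ∀ x ∈ S, x ∈ periodicPts f := fun x => mem_periodicPts_of_injOn hmaps hinj
  let orb : V → Finset V := fun x => S.filter (fun y => ∃ k, f^[k] x = y)
  have horb : ∀ x ∈ S, (orb x).card ≤ L := by
    intro x hx
    refine le_trans ?_ (hper x hx).le
    have hsub : orb x ⊆ (Finset.range (minimalPeriod f x)).image (fun k => f^[k] x) := by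
      intro y hy
      obtain ⟨k, rfl⟩ := (Finset.mem_filter.1 hy).2
      refine Finset.mem_image.2 ⟨k % minimalPeriod f x, ?_, iterate_mod_minimalPeriod_eq⟩
      exact Finset.mem_range.2
        (Nat.mod_lt _ (minimalPeriod_pos_of_mem_periodicPts (hperiodic x hx)))
    simpa using (Finset.card_le_card hsub).trans Finset.card_image_le
  have himage : S.card ≤ L * (S.image orb).card := by
    refine Finset.card_le_mul_card_image S L fun O hO => ?_
    obtain ⟨x, hx, rfl⟩ := Finset.mem_image.1 hO
    refine (Finset.card_le_card fun a ha => ?_).trans (horb x hx)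
    obtain ⟨haS, ha⟩ := Finset.mem_filter.1 ha
    rw [← ha]
    exact Finset.mem_filter.2 ⟨haS, 0, rfl⟩
  obtain ⟨F, hFS, hFinj, hFim⟩ := Finset.exists_subset_injOn_image_eq_of_surjOn (f := orb) S
    (S.image orb) (fun O hO => by simpa using hO)
  have hc : c ≤ F.card := by
    rw [← Finset.card_image_of_injOn hFinj, hFim]
    exact Nat.le_of_mul_le_mul_left (hcard.trans himage) hL
  obtain ⟨x, hx, y, hy, k, l, hkl, hne⟩ := hF F (by exact_mod_cast hFS) hc
  refine hne (hFinj hx hy ?_)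
  have hsub : ∀ x ∈ S, ∀ y ∈ S, ∀ k l, f^[k] x = f^[l] y → orb y ⊆ orb x := by
    intro x hx y hy k l hkl z hz
    obtain ⟨j, hj⟩ := exists_iterate_eq_of_iterate_eq (hperiodic y hy) hkl
    obtain ⟨hzS, i, rfl⟩ := Finset.mem_filter.1 hz
    exact Finset.mem_filter.2 ⟨hzS, i + j, by rw [iterate_add_apply, hj]⟩
  exact (hsub y (hFS hy) x (hFS hx) l k hkl.symm).antisymm (hsub x (hFS hx) y (hFS hy) k l hkl)

end Orbits

section Circuits

open Function

variable {V : Type*} {A : V → V → Prop} {S T : Finset V} {P Q : V → List V} {τ σ : V → V}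
  {r : V → V → Prop} {W : Set V} {x : V}

/-- The vertices on the closed walk starting at `x` and following alternately the paths `P`
(with end map `τ`) and `Q` (with end map `σ`). -/
def circuitVerts (P Q : V → List V) (τ σ : V → V) (x : V) : Set V :=
  {v | ∃ k, v ∈ P ((σ ∘ τ)^[k] x) ∨ v ∈ Q (τ ((σ ∘ τ)^[k] x))}

lemma IsLinkage.mapsTo_comp (hP : IsLinkage A S T P τ) (hQ : IsLinkage A T S Q σ) :
    Set.MapsTo (σ ∘ τ) ↑S ↑S :=
  fun a ha => (hQ.1 (τ a) (hP.1 a ha).1).1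

lemma IsLinkage.injOn_comp (hP : IsLinkage A S T P τ) (hQ : IsLinkage A T S Q σ) :
    Set.InjOn (σ ∘ τ) ↑S :=
  hQ.injOn.comp hP.injOn fun a ha => (hP.1 a ha).1

lemma IsLinkage.iterate_mem (hP : IsLinkage A S T P τ) (hQ : IsLinkage A T S Q σ) (hx : x ∈ S)
    (k : ℕ) : (σ ∘ τ)^[k] x ∈ S :=
  (hP.mapsTo_comp hQ).iterate k hx

lemma IsLinkage.mem_periodicPts (hP : IsLinkage A S T P τ) (hQ : IsLinkage A T S Q σ)
    (hx : x ∈ S) : x ∈ periodicPts (σ ∘ τ) :=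
  mem_periodicPts_of_injOn (hP.mapsTo_comp hQ) (hP.injOn_comp hQ) hx

lemma IsLinkage.reachIn_iterate (hP : IsLinkage A S T P τ) (hQ : IsLinkage A T S Q σ)
    (hrP : ∀ u v, LinkageEdge S P u v → r u v) (hrQ : ∀ u v, LinkageEdge T Q u v → r u v)
    (hx : x ∈ S) {i k : ℕ} (hik : i ≤ k) (hi : (σ ∘ τ)^[i] x ∈ W)
    (hW : ∀ j, i ≤ j → j < k →
      (∀ v ∈ P ((σ ∘ τ)^[j] x), v ∈ W) ∧ ∀ v ∈ Q (τ ((σ ∘ τ)^[j] x)), v ∈ W) :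
    ReachIn r W ((σ ∘ τ)^[i] x) ((σ ∘ τ)^[k] x) := by
  induction k, hik using Nat.le_induction with
  | base => exact .refl hi
  | succ k hik ih =>
    refine (ih fun j hij hjk => hW j hij (by omega)).trans ?_
    obtain ⟨hWP, hWQ⟩ := hW k hik (by omega)
    have hk := hP.iterate_mem hQ hx k
    rw [iterate_succ_apply']
    exact (hP.reachIn_head hrP hk hWP (hP.last_mem hk)).trans
      (hQ.reachIn_head hrQ (hP.1 _ hk).1 hWQ (hQ.last_mem (hP.1 _ hk).1))

lemma IsLinkage.reachIn_circuit (hP : IsLinkage A S T P τ) (hQ : IsLinkage A T S Q σ)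
    (hrP : ∀ u v, LinkageEdge S P u v → r u v) (hrQ : ∀ u v, LinkageEdge T Q u v → r u v)
    (hx : x ∈ S) {v : V} (hv : v ∈ circuitVerts P Q τ σ x) :
    ReachIn r (circuitVerts P Q τ σ x) x v ∧ ReachIn r (circuitVerts P Q τ σ x) v x := by
  have hW : ∀ j, (∀ v ∈ P ((σ ∘ τ)^[j] x), v ∈ circuitVerts P Q τ σ x) ∧
      ∀ v ∈ Q (τ ((σ ∘ τ)^[j] x)), v ∈ circuitVerts P Q τ σ x :=
    fun j => ⟨fun v hv => ⟨j, .inl hv⟩, fun v hv => ⟨j, .inr hv⟩⟩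
  have hmem := hP.iterate_mem hQ hx
  have hwalk : ∀ i k, i ≤ k →
      ReachIn r (circuitVerts P Q τ σ x) ((σ ∘ τ)^[i] x) ((σ ∘ τ)^[k] x) := fun i k hik =>
    hP.reachIn_iterate hQ hrP hrQ hx hik ((hW i).1 _ (hP.head_mem (hmem i)))
      fun j _ _ => hW j
  obtain ⟨k, hk⟩ := hv
  have hτ := (hP.1 _ (hmem k)).1
  obtain ⟨p, hp, hper⟩ := hP.mem_periodicPts hQ hx
  have hback : ReachIn r (circuitVerts P Q τ σ x) (σ (τ ((σ ∘ τ)^[k] x))) x := by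
    have h := hwalk (k + 1) ((k + 1) * p) (Nat.le_mul_of_pos_right _ hp)
    rw [(hper.const_mul (k + 1)).eq, iterate_succ_apply'] at h
    exact h
  have hQend := hQ.reachIn_head hrQ hτ (hW k).2 (hQ.last_mem hτ)
  rcases hk with hk | hk
  · exact ⟨(hwalk 0 k (Nat.zero_le _)).trans (hP.reachIn_head hrP (hmem k) (hW k).1 hk),
      (hP.reachIn_last hrP (hmem k) (hW k).1 hk).trans (hQend.trans hback)⟩
  · exact ⟨((hwalk 0 k (Nat.zero_le _)).trans
        (hP.reachIn_head hrP (hmem k) (hW k).1 (hP.last_mem (hmem k)))).trans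
        (hQ.reachIn_head hrQ hτ (hW k).2 hk),
      (hQ.reachIn_last hrQ hτ (hW k).2 hk).trans hback⟩

/-- Pairwise disjoint circuits give agreeing linkages. -/
lemma IsLinkage.exists_agreeing [Fintype V] [DecidableEq V] (hP : IsLinkage A S T P τ)
    (hQ : IsLinkage A T S Q σ) {R : Finset V} (hR : R ⊆ S)
    (hdisj : ∀ x ∈ R, ∀ y ∈ R, x ≠ y →
      Disjoint (circuitVerts P Q τ σ x) (circuitVerts P Q τ σ y)) :
    ∃ (Q' : V → List V) (σ' : V → V), IsLinkage A (R.image τ) R Q' σ' ∧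
      LinkagesAgree R (R.image τ) τ σ' ∧
      ∀ a ∈ R, ∀ b ∈ R.image τ, ¬(τ a = b ∧ σ' b = a) → ∀ v ∈ P a, v ∉ Q' b := by
  have hpath : ∀ x ∈ R, ∃ l, DipathFromTo A l (τ x) x ∧ ∀ v ∈ l, v ∈ circuitVerts P Q τ σ x := by
    intro x hx
    obtain ⟨l, hl, hhd, hlast⟩ := (hP.reachIn_circuit hQ (fun _ _ => hP.adj) (fun _ _ => hQ.adj)
      (hR hx) (v := τ x) ⟨0, .inl (hP.last_mem (hR hx))⟩).2.exists_dipathIn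
    exact ⟨l, ⟨hl.1, hhd, hlast⟩, hl.2⟩
  choose! l hl hlU using hpath
  have hinv : ∃ σ' : V → V, ∀ x ∈ R, σ' (τ x) = x := by
    rcases isEmpty_or_nonempty V with hV | hV
    · exact ⟨id, fun x => hV.elim x⟩
    · exact ⟨invFunOn τ ↑R,
        (hP.injOn.mono (by exact_mod_cast hR : (↑R : Set V) ⊆ ↑S)).leftInvOn_invFunOn⟩
  obtain ⟨σ', hσ'⟩ := hinv
  refine ⟨fun b => l (σ' b), σ', ⟨?_, ?_⟩, ?_, ?_⟩
  · simp only [Finset.forall_mem_image]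
    intro x hx
    rw [hσ' x hx]
    exact ⟨hx, hl x hx⟩
  · simp only [Finset.forall_mem_image]
    intro x hx y hy hne v hv hv'
    rw [hσ' x hx] at hv
    rw [hσ' y hy] at hv'
    exact Set.disjoint_left.1 (hdisj x hx y hy fun h => hne (h ▸ rfl)) (hlU x hx v hv)
      (hlU y hy v hv')
  · let f : V → ℕ := fun v => Fintype.equivFin V v
    have hf : Injective f := fun u v h => (Fintype.equivFin V).injective (Fin.ext h)
    refine ⟨f, fun b => f (σ' b), hf.injOn, ?_, ?_, fun _ _ _ _ h => h⟩
    · intro b hb c hc hbc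
      obtain ⟨x, hx, rfl⟩ := Finset.mem_image.1 hb
      obtain ⟨y, hy, rfl⟩ := Finset.mem_image.1 hc
      have := hf hbc
      rw [hσ' x hx, hσ' y hy] at this
      rw [this]
    · intro x hx y hy hxy
      simpa only [hσ' x hx, hσ' y hy] using hxy
  · simp only [Finset.forall_mem_image]
    intro x hx y hy hne v hv hv'
    rw [hσ' y hy] at hv' hne
    refine Set.disjoint_left.1 (hdisj x hx y hy ?_) ⟨0, .inl hv⟩ (hlU y hy v hv')
    rintro rfl
    exact hne ⟨rfl, rfl⟩

/-- Pairwise intersecting circuits give an eulerianizable subdigraph with a haven. -/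
lemma IsLinkage.exists_eulerianizable_of_circuits [Fintype V] [DecidableEq V] {n : ℕ}
    (hP : IsLinkage A S T P τ) (hQ : IsLinkage A T S Q σ)
    (hST : S.card = T.card) {R : Finset V} (hR : R ⊆ S)
    (hcard : n * 2 < R.card)
    (horb : ∀ x ∈ R, ∀ y ∈ R, ∀ k l, (σ ∘ τ)^[k] x = (σ ∘ τ)^[l] y → x = y)
    (hmeet : ∀ x ∈ R, ∀ y ∈ R, x ≠ y →
      ¬ Disjoint (circuitVerts P Q τ σ x) (circuitVerts P Q τ σ y)) :
    ∃ (S : Set V) (A' : V → V → Prop),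
      IsSubdigraph A S A' ∧ Eulerianizable A' S 4 ∧ HasHavenOn A' S (n + 1) := by
  have hempty : IsLinkage A ∅ ∅ P τ := ⟨by simp, by simp⟩
  refine exists_eulerianizable_of_linkages hP hQ hST hempty hempty rfl
    (fun Z => {x | x ∈ R ∧ circuitVerts P Q τ σ x ⊆ (↑Z : Set V)ᶜ}) ?_ ?_ ?_
  · intro Z hZ
    have hmem : ∀ x ∈ R, ∀ k, (σ ∘ τ)^[k] x ∈ S := fun x hx => hP.iterate_mem hQ (hR hx)
    obtain ⟨x, hx, h⟩ := exists_forall_not_of_functional (Z := Z) (K := R)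
      ![fun z x => ∃ k, z ∈ P ((σ ∘ τ)^[k] x), fun z x => ∃ k, z ∈ Q (τ ((σ ∘ τ)^[k] x))] (by
        intro i z _ x hx y hy
        fin_cases i
        · rintro ⟨k, hk⟩ ⟨l, hl⟩
          exact horb x hx y hy k l (hP.eq_of_mem (hmem x hx k) (hmem y hy l) hk hl)
        · rintro ⟨k, hk⟩ ⟨l, hl⟩
          exact horb x hx y hy k l (hP.injOn (hmem x hx k) (hmem y hy l)
            (hQ.eq_of_mem (hP.1 _ (hmem x hx k)).1 (hP.1 _ (hmem y hy l)).1 hk hl)))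
      (lt_of_le_of_lt (Nat.mul_le_mul_right 2 hZ) hcard)
    refine ⟨x, hx, ?_⟩
    rintro v ⟨k, hk | hk⟩ hvZ
    · exact h 0 v hvZ ⟨k, hk⟩
    · exact h 1 v hvZ ⟨k, hk⟩
  · rintro r hr₁ hr₂ - - Z - x ⟨hx, hxZ⟩ y ⟨hy, hyZ⟩
    have hreach := fun {x v : V} (hx : x ∈ R) =>
      hP.reachIn_circuit (v := v) hQ hr₁ hr₂ (hR hx)
    rcases eq_or_ne x y with rfl | hne
    · exact .refl (hxZ ⟨0, .inl (hP.head_mem (hR hx))⟩)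
    · obtain ⟨v, hvx, hvy⟩ := Set.not_disjoint_iff.1 (hmeet x hx y hy hne)
      exact ((hreach hx hvx).1.mono (fun _ _ h => h) hxZ).trans
        ((hreach hy hvy).2.mono (fun _ _ h => h) hyZ)
  · rintro Z' Z hZ x ⟨hx, hxZ⟩
    exact ⟨hx, hxZ.trans (Set.compl_subset_compl.2 (by exact_mod_cast hZ))⟩

end Circuits

section LongCircuit

open Function

/-- Disjoint paths selected from several linkages form a linkage. -/
lemma exists_isLinkage_of_transversal {V ι : Type*} [Fintype ι] [DecidableEq V]
    {A : V → V → Prop} {U W : ι → Finset V} {F : ι → V → List V} {θ : ι → V → V}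
    (hF : ∀ e, IsLinkage A (U e) (W e) (F e) (θ e)) {x : ι → V} (hx : ∀ e, x e ∈ U e)
    (hdisj : ∀ e e', e ≠ e' → ¬ ∃ v ∈ F e (x e), v ∈ F e' (x e')) :
    ∃ (P' : V → List V) (τ' : V → V),
      IsLinkage A (Finset.univ.image x) (Finset.univ.image fun e => θ e (x e)) P' τ' ∧
      (∀ e, P' (x e) = F e (x e) ∧ τ' (x e) = θ e (x e)) ∧
      (Finset.univ.image x).card = (Finset.univ.image fun e => θ e (x e)).card := by
  have hxinj : Injective x := by
    intro e e' h
    by_contra hne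
    exact hdisj e e' hne ⟨x e, (hF e).head_mem (hx e), by
      rw [h]
      exact (hF e').head_mem (hx e')⟩
  have hyinj : Injective fun e => θ e (x e) := by
    intro e e' h
    by_contra hne
    refine hdisj e e' hne ⟨_, (hF e).last_mem (hx e), ?_⟩
    simp only at h
    rw [h]
    exact (hF e').last_mem (hx e')
  have hP' : ∃ P' : V → List V, ∀ e, P' (x e) = F e (x e) :=
    ⟨extend x (fun e => F e (x e)) fun _ => [], fun e => hxinj.extend_apply _ _ e⟩
  have hτ' : ∃ τ' : V → V, ∀ e, τ' (x e) = θ e (x e) :=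
    ⟨extend x (fun e => θ e (x e)) id, fun e => hxinj.extend_apply _ _ e⟩
  obtain ⟨P', hP'⟩ := hP'
  obtain ⟨τ', hτ'⟩ := hτ'
  refine ⟨P', τ', ⟨?_, ?_⟩, fun e => ⟨hP' e, hτ' e⟩, ?_⟩
  · simp only [Finset.forall_mem_image]
    intro e _
    rw [hP', hτ']
    exact ⟨Finset.mem_image_of_mem (fun e => θ e (x e)) (Finset.mem_univ e),
      ((hF e).1 _ (hx e)).2⟩
  · simp only [Finset.forall_mem_image]
    intro e _ e' _ hne v hv hv'
    rw [hP'] at hv hv'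
    exact hdisj e e' (fun h => hne (h ▸ rfl)) ⟨v, hv, hv'⟩
  · rw [Finset.card_image_of_injective _ hxinj, Finset.card_image_of_injective _ hyinj]

/-- A very long circuit through a linked set gives an eulerianizable subdigraph with a haven. -/
lemma exists_eulerianizable_of_long_circuit (n : ℕ) : ∃ L : ℕ, 0 < L ∧
    ∀ {V : Type} [Fintype V] [DecidableEq V] {A : V → V → Prop} {X S T : Finset V}
      {P Q : V → List V} {τ σ : V → V}, Linked A X → S ⊆ X →
      IsLinkage A S T P τ → IsLinkage A T S Q σ → S.card = T.card →
      ∀ x ∈ S, L ≤ minimalPeriod (σ ∘ τ) x →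
      ∃ (S : Set V) (A' : V → V → Prop),
        IsSubdigraph A S A' ∧ Eulerianizable A' S 4 ∧ HasHavenOn A' S (n + 1) := by
  obtain ⟨M, hM⟩ := exists_transversal (Fin (4 * n + 1) × Fin (4 * n + 1)) (3 * n + 1)
  obtain ⟨m, hm⟩ : ∃ m, m = 4 * n + 1 := ⟨_, rfl⟩
  rw [← hm] at hM
  obtain ⟨D, hD⟩ : ∃ D, D = m * M := ⟨_, rfl⟩
  refine ⟨m * (2 * D) + 1, by omega, ?_⟩
  intro V _ _ A X S T P Q τ σ hX hSX hP hQ hST x hx hL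
  have hblock : ∀ (i : Fin m) (s : ℕ), s < M → i * M + s < D := by
    intro i s hs
    have : ((i : ℕ) + 1) * M ≤ m * M := Nat.mul_le_mul_right M i.2
    rw [add_mul] at this
    omega
  have hrow : ∀ i : Fin m, (i : ℕ) * (2 * D) + 2 * D ≤ m * (2 * D) := by
    intro i
    have : ((i : ℕ) + 1) * (2 * D) ≤ m * (2 * D) := Nat.mul_le_mul_right _ i.2
    rwa [add_mul, one_mul] at this
  have hrow_inj : ∀ (i j : Fin m) (p : ℕ), (i : ℕ) * (2 * D) ≤ p → p < i * (2 * D) + 2 * D →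
      (j : ℕ) * (2 * D) ≤ p → p < j * (2 * D) + 2 * D → i = j := by
    have hle : ∀ (i j : Fin m) (p : ℕ), (i : ℕ) * (2 * D) ≤ p → p < j * (2 * D) + 2 * D →
        (i : ℕ) ≤ j := by
      intro i j p hi hj
      have : (i : ℕ) * (2 * D) < (j + 1) * (2 * D) := by rw [add_mul, one_mul]; omega
      exact Nat.lt_succ_iff.1 (Nat.lt_of_mul_lt_mul_right this)
    intro i j p hi hi' hj hj'
    exact Fin.ext (le_antisymm (hle i j p hi hj') (hle j i p hj hi'))
  obtain ⟨a, ha⟩ : ∃ a : ℕ → V, a = fun p => (σ ∘ τ)^[p] x := ⟨_, rfl⟩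
  have haS : ∀ p, a p ∈ S := fun p => ha ▸ hP.iterate_mem hQ hx p
  have haT : ∀ p, τ (a p) ∈ T := fun p => (hP.1 _ (haS p)).1
  have hainj : ∀ p < m * (2 * D), ∀ q < m * (2 * D), a p = a q → p = q := by
    intro p hp q hq hpq
    rw [ha] at hpq
    exact iterate_injOn_Iio_minimalPeriod (Set.mem_Iio.2 (by omega)) (Set.mem_Iio.2 (by omega)) hpq
  -- disjoint blocks of positions at which the connecting paths start and end
  let outBlock : Fin m × Fin m → Finset V := fun e =>
    (Finset.range M).image fun s => a (e.1 * (2 * D) + D + (e.2 * M + s))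
  let inBlock : Fin m × Fin m → Finset V := fun e =>
    (Finset.range M).image fun s => a (e.2 * (2 * D) + (e.1 * M + s))
  have hout : ∀ e, (outBlock e).card = M := by
    intro e
    rw [Finset.card_image_of_injOn, Finset.card_range]
    intro s hs t ht hst
    have hs := hblock e.2 s (by simpa using hs)
    have ht := hblock e.2 t (by simpa using ht)
    have := hrow e.1
    have := hainj _ (by omega) _ (by omega) hst
    omega
  have hin : ∀ e, (inBlock e).card = M := by
    intro e
    rw [Finset.card_image_of_injOn, Finset.card_range]
    intro s hs t ht hst
    have hs := hblock e.1 s (by simpa using hs)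
    have ht := hblock e.1 t (by simpa using ht)
    have := hrow e.2
    have := hainj _ (by omega) _ (by omega) hst
    omega
  have houtX : ∀ e, outBlock e ⊆ X := fun e =>
    Finset.image_subset_iff.2 fun s _ => hSX (haS _)
  have hinX : ∀ e, inBlock e ⊆ X := fun e =>
    Finset.image_subset_iff.2 fun s _ => hSX (haS _)
  have hF := fun e => hX (outBlock e) (inBlock e) (houtX e) (hinX e) ((hout e).trans (hin e).symm)
  choose F θ hF using hF
  rcases hM (fun e e' u v => ∃ w ∈ F e u, w ∈ F e' v) outBlock (fun e => (hout e).ge) with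
    ⟨e, e', -, S₁, hS₁, S₂, hS₂, hc₁, hc₂, hmeet⟩ | ⟨y, hy, hdisj⟩
  · refine exists_eulerianizable_of_grid hX ((hF e).restrict hS₁) ((hF e').restrict hS₂)
      (hS₁.trans (houtX e)) (((hF e).image_subset hS₁).trans (hinX e))
      (hS₂.trans (houtX e')) (((hF e').image_subset hS₂).trans (hinX e'))
      ((hF e).card_image hS₁).symm ((hF e').card_image hS₂).symm (by omega) (by omega) hmeet
  obtain ⟨P', τ', hP', hval, hcard'⟩ := exists_isLinkage_of_transversal hF hy hdisj
  obtain ⟨Q', σ', hQ'⟩ := hX _ _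
    (Finset.image_subset_iff.2 fun e _ => hinX e ((hF e).1 _ (hy e)).1)
    (Finset.image_subset_iff.2 fun e _ => houtX e (hy e)) hcard'.symm
  have hystart : ∀ e, ∃ p, (e.1 : ℕ) * (2 * D) + D ≤ p ∧ p < e.1 * (2 * D) + 2 * D ∧ y e = a p := by
    intro e
    obtain ⟨s, hs, h⟩ := Finset.mem_image.1 (hy e)
    have := hblock e.2 s (by simpa using hs)
    exact ⟨_, by omega, by omega, h.symm⟩
  have hyend : ∀ e, ∃ p, (e.2 : ℕ) * (2 * D) ≤ p ∧ p < e.2 * (2 * D) + D ∧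
      θ e (y e) = a p := by
    intro e
    obtain ⟨s, hs, h⟩ := Finset.mem_image.1 ((hF e).1 _ (hy e)).1
    have := hblock e.1 s (by simpa using hs)
    exact ⟨_, by omega, by omega, h.symm⟩
  let intact : Finset V → Fin m → Prop := fun Z i => ∀ p, (i : ℕ) * (2 * D) ≤ p →
    p < i * (2 * D) + 2 * D →
    (∀ v ∈ P (a p), v ∈ (↑Z : Set V)ᶜ) ∧ ∀ v ∈ Q (τ (a p)), v ∈ (↑Z : Set V)ᶜ
  let free : Finset V → Fin m × Fin m → Prop := fun Z e => ∀ v ∈ F e (y e), v ∈ (↑Z : Set V)ᶜ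
  have hgood : ∀ Z : Finset V, Z.card ≤ n → ∀ i j, ∃ k, intact Z k ∧ free Z (i, k) ∧
      free Z (k, j) := by
    intro Z hZ i j
    obtain ⟨k, -, h⟩ := exists_forall_not_of_functional (Z := Z)
      (K := (Finset.univ : Finset (Fin m)))
      ![fun z k => ∃ p, (k : ℕ) * (2 * D) ≤ p ∧ p < k * (2 * D) + 2 * D ∧ z ∈ P (a p),
        fun z k => ∃ p, (k : ℕ) * (2 * D) ≤ p ∧ p < k * (2 * D) + 2 * D ∧ z ∈ Q (τ (a p)),
        fun z k => z ∈ F (i, k) (y (i, k)), fun z k => z ∈ F (k, j) (y (k, j))] (by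
        have hrows : ∀ (k l : Fin m) (p q : ℕ), (k : ℕ) * (2 * D) ≤ p → p < k * (2 * D) + 2 * D →
            (l : ℕ) * (2 * D) ≤ q → q < l * (2 * D) + 2 * D → a p = a q → k = l := by
          intro k l p q hp hp' hq hq' hpq
          have h1 := hrow k
          have h2 := hrow l
          obtain rfl := hainj p (by omega) q (by omega) hpq
          exact hrow_inj k l p hp hp' hq hq'
        intro c z _ k _ l _
        fin_cases c
        · rintro ⟨p, hp, hp', hz⟩ ⟨q, hq, hq', hz'⟩
          exact hrows k l p q hp hp' hq hq' (hP.eq_of_mem (haS p) (haS q) hz hz')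
        · rintro ⟨p, hp, hp', hz⟩ ⟨q, hq, hq', hz'⟩
          exact hrows k l p q hp hp' hq hq'
            (hP.injOn (haS p) (haS q) (hQ.eq_of_mem (haT p) (haT q) hz hz'))
        · intro hz hz'
          by_contra hne
          exact hdisj (i, k) (i, l) (by simpa using hne) ⟨z, hz, hz'⟩
        · intro hz hz'
          by_contra hne
          exact hdisj (k, j) (l, j) (by simpa using hne) ⟨z, hz, hz'⟩)
      (by rw [Finset.card_univ, Fintype.card_fin]; omega)
    exact ⟨k, fun p hp hp' => ⟨fun v hv hvZ => h 0 v hvZ ⟨p, hp, hp', hv⟩,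
      fun v hv hvZ => h 1 v hvZ ⟨p, hp, hp', hv⟩⟩, fun v hv hvZ => h 2 v hvZ hv,
      fun v hv hvZ => h 3 v hvZ hv⟩
  refine exists_eulerianizable_of_linkages hP hQ hST hP' hQ' hcard'
    (fun Z => {v | ∃ i : Fin m, v = a (i * (2 * D) + D) ∧ intact Z i}) ?_ ?_ ?_
  · intro Z hZ
    have i₀ : Fin m := ⟨0, by omega⟩
    obtain ⟨k, hk, -⟩ := hgood Z hZ i₀ i₀
    exact ⟨_, k, rfl, hk⟩
  · rintro r hr₁ hr₂ hr₃ - Z hZ _ ⟨i, rfl, hi⟩ _ ⟨j, rfl, hj⟩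
    have hwalk : ∀ k, intact Z k → ∀ p q, p ≤ q → (k : ℕ) * (2 * D) ≤ p →
        q < k * (2 * D) + 2 * D → ReachIn r (↑Z)ᶜ (a p) (a q) := by
      intro k hk p q hpq hp hq
      have hmem : a p ∈ (↑Z : Set V)ᶜ := (hk p hp (by omega)).1 _ (hP.head_mem (haS p))
      rw [ha] at hmem ⊢
      refine hP.reachIn_iterate hQ hr₁ hr₂ hx hpq hmem fun l hl hl' => ?_
      have := hk l (by omega) (by omega)
      rwa [ha] at this
    have hstep : ∀ i k : Fin m, intact Z i → intact Z k → free Z (i, k) →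
        ReachIn r (↑Z)ᶜ (a (i * (2 * D) + D)) (a (k * (2 * D) + D)) := by
      intro i k hi hk hik
      obtain ⟨p, hp, hp', hpy⟩ := hystart (i, k)
      obtain ⟨q, hq, hq', hqy⟩ := hyend (i, k)
      have hyS : y (i, k) ∈ Finset.univ.image y := Finset.mem_image_of_mem _ (Finset.mem_univ _)
      have hpath := hP'.reachIn_head hr₃ hyS (W := (↑Z : Set V)ᶜ)
        (by rw [(hval (i, k)).1]; exact hik) (hP'.last_mem hyS)
      rw [(hval (i, k)).2, hqy, hpy] at hpath
      simp only at hp hp' hq hq'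
      exact (hwalk i hi _ p hp (by omega) hp').trans
        (hpath.trans (hwalk k hk q _ (by omega) hq (by omega)))
    obtain ⟨k, hk, hik, hkj⟩ := hgood Z hZ i j
    exact (hstep i k hi hk hik).trans (hstep k j hk hj hkj)
  · rintro Z' Z hZ v ⟨i, hv, hi⟩
    have hsub : (↑Z : Set V)ᶜ ⊆ (↑Z' : Set V)ᶜ :=
      Set.compl_subset_compl.2 (by exact_mod_cast hZ)
    exact ⟨i, hv, fun p hp hp' => ⟨fun v hv => hsub ((hi p hp hp').1 v hv),
      fun v hv => hsub ((hi p hp hp').2 v hv)⟩⟩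

end LongCircuit

/-- For every `n ≥ 1` there is `N` such that for any linked set `X` in a
finite digraph and disjoint `A, B ⊆ X` of size `N`, either there are `A* ⊆ A`, `B* ⊆ B` of
size `n` with agreeing linkages in both directions, the linkages being pairwise vertex-disjoint
except that the two paths joining the same pair of vertices may share vertices; or the digraph
has a `4`-eulerianizable subdigraph with a haven of order `n + 1`. -/
theorem agreeing_linkages_or_eulerianizable (n : ℕ) (hn : 0 < n) :
    ∃ N : ℕ, 0 < N ∧
      ∀ (V : Type) [Fintype V] [DecidableEq V] (A : V → V → Prop)
        (X Aset Bset : Finset V),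
        Linked A X → Aset ⊆ X → Bset ⊆ X → Disjoint Aset Bset →
        Aset.card = N → Bset.card = N →
        (∃ (Astar Bstar : Finset V) (P : V → List V) (τ : V → V)
            (Q : V → List V) (σ : V → V),
          Astar ⊆ Aset ∧ Bstar ⊆ Bset ∧ Astar.card = n ∧ Bstar.card = n ∧
          IsLinkage A Astar Bstar P τ ∧ IsLinkage A Bstar Astar Q σ ∧
          LinkagesAgree Astar Bstar τ σ ∧
          (∀ a ∈ Astar, ∀ b ∈ Bstar, ¬(τ a = b ∧ σ b = a) → ∀ v ∈ P a, v ∉ Q b)) ∨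
        (∃ (S : Set V) (A' : V → V → Prop),
          IsSubdigraph A S A' ∧ Eulerianizable A' S 4 ∧ HasHavenOn A' S (n + 1)) := by
  obtain ⟨c, hc⟩ := exists_ramsey n (2 * n + 1)
  obtain ⟨L, hL, hlong⟩ := exists_eulerianizable_of_long_circuit n
  refine ⟨L * (c + 1), by positivity, ?_⟩
  intro V _ _ A X Aset Bset hX hAX hBX _ hA hB
  have hcard : Aset.card = Bset.card := hA.trans hB.symm
  obtain ⟨P, τ, hP⟩ := hX Aset Bset hAX hBX hcard
  obtain ⟨Q, σ, hQ⟩ := hX Bset Aset hBX hAX hcard.symm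
  rcases exists_long_orbit_or_many_orbits (hP.mapsTo_comp hQ) (hP.injOn_comp hQ) hL hA.ge with
    ⟨x, hx, hper⟩ | ⟨F, hF, hFcard, horb⟩
  · exact .inr (hlong hX hAX hP hQ hcard x hx hper)
  rcases hc (fun x y => Disjoint (circuitVerts P Q τ σ x) (circuitVerts P Q τ σ y))
    (fun _ _ h => h.symm) F (by omega) with ⟨R, hR, hRcard, hdisj⟩ | ⟨R, hR, hRcard, hmeet⟩
  · obtain ⟨Q', σ', hQ', hagree, hQdisj⟩ := hP.exists_agreeing hQ (hR.trans hF) hdisj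
    exact .inl ⟨R, R.image τ, P, τ, Q', σ', hR.trans hF, hP.image_subset (hR.trans hF), hRcard,
      (hP.card_image (hR.trans hF)).trans hRcard, hP.restrict (hR.trans hF), hQ', hagree, hQdisj⟩
  · exact .inr (hP.exists_eulerianizable_of_circuits hQ hcard (hR.trans hF) (by omega)
      (fun x hx y hy => horb x (hR hx) y (hR hy)) hmeet)
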